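/- If X has a log-concave distribution on R^n with density f, then for any 1 ≤ p ≤ q ≤ ∞, h_p(X)/n ≤ (log p)/(p-1) + h_q(X)/n (with (log p)/(p-1) interpreted as 1 at p = 1 and 0 at p = ∞). -/

import Mathlib

open MeasureTheory Real ENNReal

noncomputable section

/-- Rényi entropy of order `p ∈ [1,∞]` of a density `f` on R^n:
`h_1` is Shannon differential entropy, `h_∞ = log (1/‖f‖_∞)`, and for `1 < p < ∞`,
`h_p = (p/(p-1)) log (1/‖f‖_p)`. -/
def renyiEntropy (n : ℕ) (f : EuclideanSpace ℝ (Fin n) → ℝ) (p : ℝ≥0∞) : ℝ :=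
  if p = 1 then -∫ x, f x * Real.log (f x)
  else if p = ⊤ then Real.log (essSup f volume)⁻¹
  else (p.toReal / (p.toReal - 1)) * Real.log ((∫ x, f x ^ p.toReal) ^ (1 / p.toReal))⁻¹

/-- The constant `(log p)/(p-1)`, interpreted as `1` at `p = 1` and `0` at `p = ∞`. -/
def renyiCoef (p : ℝ≥0∞) : ℝ :=
  if p = 1 then 1 else if p = ⊤ then 0 else Real.log p.toReal / (p.toReal - 1)

/-- Scaling inequality for integrable log-concave functions. -/
theorem scaling_aux (n : ℕ) (f : EuclideanSpace ℝ (Fin n) → ℝ)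
    (hf : ∀ x, 0 ≤ f x) (hmeas : Measurable f) (hint : Integrable f)
    (hlc : ∀ x y : EuclideanSpace ℝ (Fin n), ∀ a b : ℝ, 0 ≤ a → 0 ≤ b → a + b = 1 →
      f x ^ a * f y ^ b ≤ f (a • x + b • y))
    (p : ℝ) (hp0 : 0 < p) (hp1 : p < 1) (x0 : EuclideanSpace ℝ (Fin n)) (hx0 : 0 < f x0) :
    Integrable (fun x => f x ^ p) ∧ f x0 ^ (1 - p) * ∫ x, f x ^ p ≤ (p ^ n)⁻¹ * ∫ x, f x := by
  have hpos : 0 < f x0 ^ (1 - p) := Real.rpow_pos_of_pos hx0 _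
  have hle : ∀ x, f x0 ^ (1 - p) * f x ^ p ≤ f (p • x + (1 - p) • x0) := by
    intro x
    rw [mul_comm]
    exact hlc x x0 p (1 - p) hp0.le (by linarith) (by ring)
  have hint1 : Integrable (fun x => f (x + (1 - p) • x0)) := hint.comp_add_right _
  have hint2 : Integrable (fun x => f (p • x + (1 - p) • x0)) :=
    hint1.comp_smul hp0.ne'
  have hint3 : Integrable (fun x => f x0 ^ (1 - p) * f x ^ p) := by
    refine hint2.mono' ((hmeas.pow_const p).const_mul _).aestronglyMeasurable ?_
    refine Filter.Eventually.of_forall fun x => ?_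
    rw [Real.norm_of_nonneg (mul_nonneg hpos.le (Real.rpow_nonneg (hf x) _))]
    exact hle x
  refine ⟨?_, ?_⟩
  · have := hint3.const_mul (f x0 ^ (1 - p))⁻¹
    refine this.congr (Filter.Eventually.of_forall fun x => ?_)
    simp only
    rw [← mul_assoc, inv_mul_cancel₀ hpos.ne', one_mul]
  · rw [← integral_const_mul]
    calc _ ≤ ∫ x, f (p • x + (1 - p) • x0) := integral_mono hint3 hint2 hle
      _ = (p ^ n)⁻¹ * ∫ x, f (x + (1 - p) • x0) := by
        rw [Measure.integral_comp_smul_of_nonneg volume (fun x => f (x + (1 - p) • x0)) p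
          (hR := hp0.le)]
        simp
      _ = _ := by rw [integral_add_right_eq_self f]

theorem bounded_aux (n : ℕ) (f : EuclideanSpace ℝ (Fin n) → ℝ)
    (hf : ∀ x, 0 ≤ f x) (hmeas : Measurable f)
    (hprob : ∫ x, f x = 1)
    (hlc : ∀ x y : EuclideanSpace ℝ (Fin n), ∀ a b : ℝ, 0 ≤ a → 0 ≤ b → a + b = 1 →
      f x ^ a * f y ^ b ≤ f (a • x + b • y)) :
    Integrable f ∧ Integrable (fun x => f x ^ (1 / 2 : ℝ)) ∧ ∃ C, 0 < C ∧ ∀ x, f x ≤ C := by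
  have hint : Integrable f := by
    by_contra h
    rw [integral_undef h] at hprob
    exact zero_ne_one hprob
  have hex : ∃ x0, 0 < f x0 := by
    by_contra! h
    have : f = 0 := funext fun x => le_antisymm (h x) (hf x)
    rw [this] at hprob
    simp at hprob
  obtain ⟨x0, hx0⟩ := hex
  have key := scaling_aux n f hf hmeas hint hlc (1 / 2) (by norm_num) (by norm_num)
  have hI := (key x0 hx0).1
  refine ⟨hint, hI, ?_⟩
  have hIpos : 0 < ∫ x, f x ^ (1 / 2 : ℝ) := by
    have h0 : 0 ≤ ∫ x, f x ^ (1 / 2 : ℝ) :=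
      integral_nonneg fun x => Real.rpow_nonneg (hf x) _
    rcases h0.lt_or_eq with h | h
    · exact h
    exfalso
    have h1 := (integral_eq_zero_iff_of_nonneg (fun x => Real.rpow_nonneg (hf x) _) hI).1 h.symm
    have h2 : f =ᵐ[volume] 0 := by
      filter_upwards [h1] with x hx
      simp only [Pi.zero_apply] at hx ⊢
      exact ((Real.rpow_eq_zero (hf x) (by norm_num)).1 hx)
    rw [integral_congr_ae h2] at hprob
    simp at hprob
  set I := ∫ x, f x ^ (1 / 2 : ℝ)
  set D := (((1 / 2 : ℝ)) ^ n)⁻¹ / I with hD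
  have hDpos : 0 < D := by positivity
  refine ⟨D ^ 2, by positivity, fun x => ?_⟩
  rcases (hf x).lt_or_eq with h | h
  · have h3 := (key x h).2
    rw [hprob, mul_one, ← le_div_iff₀ hIpos, ← hD] at h3
    norm_num at h3
    rw [← Real.sqrt_eq_rpow] at h3
    calc f x = (√(f x)) ^ 2 := (Real.sq_sqrt h.le).symm
      _ ≤ D ^ 2 := by gcongr
  · rw [← h]; positivity

theorem essSup_bd_aux (n : ℕ) (f : EuclideanSpace ℝ (Fin n) → ℝ)
    (hf : ∀ x, 0 ≤ f x) (K : ℝ) (hK : ∀ x, f x ≤ K) : essSup f volume ≤ K := by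
  refine essSup_le_of_ae_le K (Filter.Eventually.of_forall hK) ?_
  exact Filter.IsBoundedUnder.isCoboundedUnder_le
    ⟨0, Filter.eventually_map.2 (Filter.Eventually.of_forall hf)⟩

/-- `f log f` is integrable. -/
theorem flogf_aux (n : ℕ) (f : EuclideanSpace ℝ (Fin n) → ℝ)
    (hf : ∀ x, 0 ≤ f x) (hmeas : Measurable f) (hint : Integrable f)
    (hI : Integrable (fun x => f x ^ (1 / 2 : ℝ))) (C : ℝ) (hC : 0 < C) (hle : ∀ x, f x ≤ C) :
    Integrable (fun x => f x * Real.log (f x)) := by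
  have hdom : Integrable (fun x => 2 * f x ^ (1 / 2 : ℝ) + |Real.log C| * f x) :=
    (hI.const_mul 2).add (hint.const_mul _)
  refine hdom.mono' (hmeas.mul (Real.measurable_log.comp hmeas)).aestronglyMeasurable ?_
  refine Filter.Eventually.of_forall fun x => ?_
  rw [← Real.sqrt_eq_rpow]
  rcases (hf x).lt_or_eq with h | h
  · have hs : 0 < √(f x) := Real.sqrt_pos.2 h
    have hsq : √(f x) * √(f x) = f x := Real.mul_self_sqrt h.le
    have h1 : Real.log (f x) ≤ |Real.log C| :=
      (Real.log_le_log h (hle x)).trans (le_abs_self _)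
    have h2 := Real.one_sub_inv_le_log_of_pos hs
    rw [Real.log_sqrt h.le] at h2
    have h3 : f x * (√(f x))⁻¹ = √(f x) := by
      rw [← div_eq_mul_inv, Real.div_sqrt]
    have h4 := mul_le_mul_of_nonneg_left h2 h.le
    rw [mul_sub, h3] at h4
    have h5 := mul_le_mul_of_nonneg_left h1 h.le
    have h6 : 0 ≤ |Real.log C| * f x := by positivity
    rw [Real.norm_eq_abs, abs_le]
    constructor <;> nlinarith
  · rw [← h]; simp

/-- `h_1 ≤ n - log f(x₀)`. -/
theorem shannon_aux (n : ℕ) (f : EuclideanSpace ℝ (Fin n) → ℝ)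
    (hf : ∀ x, 0 ≤ f x) (hmeas : Measurable f) (hint : Integrable f)
    (hprob : ∫ x, f x = 1)
    (hlc : ∀ x y : EuclideanSpace ℝ (Fin n), ∀ a b : ℝ, 0 ≤ a → 0 ≤ b → a + b = 1 →
      f x ^ a * f y ^ b ≤ f (a • x + b • y))
    (hL : Integrable (fun x => f x * Real.log (f x)))
    (x0 : EuclideanSpace ℝ (Fin n)) (hx0 : 0 < f x0) :
    -∫ x, f x * Real.log (f x) ≤ n - Real.log (f x0) := by
  set H := -∫ x, f x * Real.log (f x) with hH
  set L := Real.log (f x0) with hLdef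
  let G : ℝ → ℝ := fun s => Real.exp (-(n * Real.log (1 - s)) - s * L)
  have hG0 : G 0 = 1 := by simp [G]
  have hmain : ∀ s, 0 < s → s < 1 → s * H ≤ G s - G 0 := by
    intro s hs0 hs1
    obtain ⟨hA, hB⟩ := scaling_aux n f hf hmeas hint hlc (1 - s) (by linarith) (by linarith) x0 hx0
    rw [hprob, mul_one, _root_.sub_sub_cancel] at hB
    have h1 : ∫ x, (f x + (-s) * (f x * Real.log (f x))) ≤ ∫ x, f x ^ (1 - s) := by
      refine integral_mono (hint.add (hL.const_mul _)) hA fun x => ?_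
      simp only
      rcases (hf x).lt_or_eq with h | h
      · have h2 := Real.add_one_le_exp (Real.log (f x) * (-s))
        rw [sub_eq_add_neg, Real.rpow_add h, Real.rpow_one, Real.rpow_def_of_pos h (-s)]
        nlinarith [mul_le_mul_of_nonneg_left h2 h.le]
      · rw [← h, Real.zero_rpow (by linarith)]; simp
    rw [integral_add hint (hL.const_mul _), integral_const_mul, hprob] at h1
    have h3 : G s = ((1 - s) ^ n)⁻¹ * (f x0 ^ s)⁻¹ := by
      simp only [G]
      rw [sub_eq_add_neg, Real.exp_add, Real.exp_neg, Real.exp_neg, Real.exp_nat_mul,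
        Real.exp_log (by linarith), Real.rpow_def_of_pos hx0, mul_comm s L]
    have h4 : ∫ x, f x ^ (1 - s) ≤ G s := by
      rw [h3, ← div_eq_mul_inv, le_div_iff₀ (Real.rpow_pos_of_pos hx0 _), mul_comm]
      exact hB
    rw [hG0]
    have : s * H = -s * ∫ x, f x * Real.log (f x) := by rw [hH]; ring
    linarith
  have hder : HasDerivAt G (n - L) 0 := by
    have h1 : HasDerivAt (fun s : ℝ => Real.log (1 - s)) (-1 / (1 - 0)) 0 :=
      (((hasDerivAt_id (0:ℝ)).const_sub 1)).log (by norm_num)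
    have h2 := (((h1.const_mul (n:ℝ)).neg).sub ((hasDerivAt_id (0:ℝ)).mul_const L)).exp
    have h3 : HasDerivAt G _ 0 := h2
    convert h3 using 1
    simp
  have ht := hder.tendsto_slope_zero_right
  refine ge_of_tendsto ht ?_
  filter_upwards [Ioo_mem_nhdsGT (zero_lt_one' ℝ)] with s hs
  rw [zero_add, smul_eq_mul, inv_mul_eq_div, le_div_iff₀ hs.1, mul_comm]
  exact hmain s hs.1 hs.2

/-- `h_p ≤ n log p / (p-1) - log f(x₀)`, for `1 < p < ∞`. -/
theorem renyi_aux (n : ℕ) (f : EuclideanSpace ℝ (Fin n) → ℝ)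
    (hf : ∀ x, 0 ≤ f x) (hmeas : Measurable f)
    (hprob : ∫ x, f x = 1)
    (hlc : ∀ x y : EuclideanSpace ℝ (Fin n), ∀ a b : ℝ, 0 ≤ a → 0 ≤ b → a + b = 1 →
      f x ^ a * f y ^ b ≤ f (a • x + b • y))
    (p : ℝ) (hp : 1 < p) (hI : Integrable (fun x => f x ^ p))
    (x0 : EuclideanSpace ℝ (Fin n)) (hx0 : 0 < f x0) :
    0 < ∫ x, f x ^ p ∧ 
    (p - 1) * Real.log (f x0) ≤ n * Real.log p + Real.log (∫ x, f x ^ p) := by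
  have hp0 : 0 < p := by linarith
  have key := (scaling_aux n (fun x => f x ^ p) (fun x => Real.rpow_nonneg (hf x) _)
    (hmeas.pow_const p) hI (by
      intro x y a b ha hb hab
      have := Real.rpow_le_rpow (mul_nonneg (Real.rpow_nonneg (hf x) a)
        (Real.rpow_nonneg (hf y) b)) (hlc x y a b ha hb hab) hp0.le
      rw [Real.mul_rpow (Real.rpow_nonneg (hf x) a) (Real.rpow_nonneg (hf y) b),
        ← Real.rpow_mul (hf x), ← Real.rpow_mul (hf y)] at this
      rw [← Real.rpow_mul (hf x), ← Real.rpow_mul (hf y), mul_comm p a, mul_comm p b]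
      exact this) p⁻¹ (by positivity) (inv_lt_one_of_one_lt₀ hp) x0
      (Real.rpow_pos_of_pos hx0 _)).2
  have h1 : ∀ x, (f x ^ p) ^ p⁻¹ = f x := fun x => Real.rpow_rpow_inv (hf x) hp0.ne'
  simp only [h1] at key
  rw [hprob, mul_one, ← Real.rpow_mul (hf x0), mul_sub, mul_one, mul_inv_cancel₀ hp0.ne',
    inv_pow, inv_inv] at key
  have hpos : 0 < f x0 ^ (p - 1) := Real.rpow_pos_of_pos hx0 _
  have hIpos : 0 < ∫ x, f x ^ p := by
    by_contra! h
    have : p ^ n * ∫ x, f x ^ p ≤ 0 := mul_nonpos_of_nonneg_of_nonpos (by positivity) h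
    linarith
  refine ⟨hIpos, ?_⟩
  have h2 := Real.log_le_log hpos key
  rwa [Real.log_rpow hx0, Real.log_mul (by positivity) hIpos.ne', Real.log_pow] at h2

/-- The finite order Rényi entropy in a convenient form. -/
theorem renyi_form_aux (p I : ℝ) (hp : 1 < p) (hI : 0 < I) :
    (p / (p - 1)) * Real.log (I ^ (1 / p))⁻¹ = - Real.log I / (p - 1) := by
  have h1 : p - 1 ≠ 0 := by linarith
  have h0 : p ≠ 0 := by linarith
  rw [Real.log_inv, Real.log_rpow hI]
  field_simp

theorem toReal_aux (p : ℝ≥0∞) (hp : 1 ≤ p) (h1 : p ≠ 1) (ht : p ≠ ⊤) : 1 < p.toReal := by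
  have : 1 < p := lt_of_le_of_ne hp (Ne.symm h1)
  have h := (ENNReal.toReal_lt_toReal ENNReal.one_ne_top ht).2 this
  simpa using h

/-- for a log-concave density f on R^n and 1 ≤ p ≤ q ≤ ∞,
h_p(X)/n ≤ (log p)/(p-1) + h_q(X)/n. -/
theorem renyi_comparison_logconcave
    (n : ℕ) (hn : 0 < n)
    (f : EuclideanSpace ℝ (Fin n) → ℝ)
    (hf : ∀ x, 0 ≤ f x) (hmeas : Measurable f)
    (hprob : ∫ x, f x = 1)
    (hlc : ∀ x y : EuclideanSpace ℝ (Fin n), ∀ a b : ℝ, 0 ≤ a → 0 ≤ b → a + b = 1 →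
      f x ^ a * f y ^ b ≤ f (a • x + b • y))
    (p q : ℝ≥0∞) (hp : 1 ≤ p) (hpq : p ≤ q)
    : renyiEntropy n f p / n ≤ renyiCoef p + renyiEntropy n f q / n := by
  obtain ⟨hint, hhalf, C, hC, hCle⟩ := bounded_aux n f hf hmeas hprob hlc
  have hL := flogf_aux n f hf hmeas hint hhalf C hC hCle
  have hpow : ∀ r : ℝ, 1 < r → Integrable (fun x => f x ^ r) := by
    intro r hr
    refine (hint.const_mul (C ^ (r - 1))).mono' (hmeas.pow_const r).aestronglyMeasurable ?_
    refine Filter.Eventually.of_forall fun x => ?_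
    rw [Real.norm_of_nonneg (Real.rpow_nonneg (hf x) _)]
    rcases (hf x).lt_or_eq with h | h
    · calc f x ^ r = f x ^ (r - 1) * f x := by
            rw [← Real.rpow_add_one h.ne']; ring_nf
        _ ≤ C ^ (r - 1) * f x := by
            gcongr
            exact hCle x
    · rw [← h, Real.zero_rpow (by linarith)]; simp
  have hex : ∃ x0, 0 < f x0 := by
    by_contra! h
    have : f = 0 := funext fun x => le_antisymm (h x) (hf x)
    rw [this] at hprob
    simp at hprob
  set M := essSup f volume with hM
  have hMle : ∀ᵐ x, f x ≤ M :=
    ae_le_essSup ⟨C, Filter.eventually_map.2 (Filter.Eventually.of_forall hCle)⟩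
  have hMpos : 0 < M := by
    by_contra! h
    have h2 : f =ᵐ[volume] 0 := by
      filter_upwards [hMle] with x hx
      exact le_antisymm (hx.trans h) (hf x)
    rw [integral_congr_ae h2] at hprob
    simp at hprob
  have hn' : (0 : ℝ) < n := by exact_mod_cast hn
  have hlogM : ∀ K, (∀ x, 0 < f x → Real.log (f x) ≤ K) → Real.log M ≤ K := by
    intro K hK
    rw [Real.log_le_iff_le_exp hMpos]
    refine essSup_bd_aux n f hf _ fun x => ?_
    rcases (hf x).lt_or_eq with h | h
    · exact (Real.log_le_iff_le_exp h).1 (hK x h)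
    · rw [← h]; positivity
  have hlow : -Real.log M ≤ renyiEntropy n f q := by
    unfold renyiEntropy
    split_ifs with h1 h2
    · refine neg_le_neg ?_
      have : ∫ x, f x * Real.log (f x) ≤ ∫ x, f x * Real.log M := by
        refine integral_mono_ae hL (hint.mul_const _) ?_
        filter_upwards [hMle] with x hx
        rcases (hf x).lt_or_eq with h | h
        · exact mul_le_mul_of_nonneg_left (Real.log_le_log h hx) h.le
        · rw [← h]; simp
      rwa [integral_mul_const, hprob, one_mul] at this
    · rw [Real.log_inv]
    · have hq1 := toReal_aux q (hp.trans hpq) h1 h2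
      set r := q.toReal
      obtain ⟨x0, hx0⟩ := hex
      have hI := (renyi_aux n f hf hmeas hprob hlc r hq1 (hpow r hq1) x0 hx0).1
      rw [renyi_form_aux r _ hq1 hI, le_div_iff₀ (by linarith)]
      have : ∫ x, f x ^ r ≤ ∫ x, M ^ (r - 1) * f x := by
        refine integral_mono_ae (hpow r hq1) (hint.const_mul _) ?_
        filter_upwards [hMle] with x hx
        rcases (hf x).lt_or_eq with h | h
        · calc f x ^ r = f x ^ (r - 1) * f x := by
                rw [← Real.rpow_add_one h.ne']; ring_nf
            _ ≤ M ^ (r - 1) * f x := by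
                gcongr
        · rw [← h, Real.zero_rpow (by linarith)]; simp
      rw [integral_const_mul, hprob, mul_one] at this
      have h3 := Real.log_le_log hI this
      rw [Real.log_rpow hMpos] at h3
      linarith
  have hup : renyiEntropy n f p ≤ n * renyiCoef p - Real.log M := by
    unfold renyiEntropy renyiCoef
    split_ifs with h1 h2
    · have := hlogM (n + ∫ x, f x * Real.log (f x)) fun x hx => by
        have := shannon_aux n f hf hmeas hint hprob hlc hL x hx
        linarith
      linarith
    · rw [Real.log_inv]; simp [hM]
    · have hp1 := toReal_aux p hp h1 h2
      set r := p.toReal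
      have hr : 0 < r - 1 := by linarith
      obtain ⟨x0, hx0⟩ := hex
      have hI := (renyi_aux n f hf hmeas hprob hlc r hp1 (hpow r hp1) x0 hx0).1
      rw [renyi_form_aux r _ hp1 hI]
      have := hlogM ((n * Real.log r + Real.log (∫ x, f x ^ r)) / (r - 1)) fun x hx => by
        rw [le_div_iff₀ hr, mul_comm]
        exact (renyi_aux n f hf hmeas hprob hlc r hp1 (hpow r hp1) x hx).2
      rw [add_div, mul_div_assoc] at this
      rw [neg_div]
      linarith
  rw [div_le_iff₀ hn', add_mul, div_mul_cancel₀ _ hn'.ne']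
  linarith

end
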